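/- For every finite-dimensional left A-module M, the rank variety V^r_A(M) = {0} ∪ {λ ∈ k^c \ {0} : M is not a free k[u_λ]-module} is a homogeneous affine subset of k^c: it is closed under multiplication by scalars from k, and it is Zariski closed, i.e. it is the common zero set of a family of polynomials in k[t_1, …, t_c]. -/

import Mathlib

/-- The defining relations of the homogeneous quantum complete intersection with `c`
generators `x_i`, all exponents equal to `a`, and all commutators equal to `q`:
`x_i ^ a = 0` for all `i`, and `x_i x_j = q • (x_j x_i)` for `i < j`. -/
inductive QCIRel (k : Type) [Field k] (c a : ℕ) (q : k) :
    FreeAlgebra k (Fin c) → FreeAlgebra k (Fin c) → Prop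
  | pow (i : Fin c) : QCIRel k c a q (FreeAlgebra.ι k i ^ a) 0
  | comm (i j : Fin c) (hij : i < j) :
      QCIRel k c a q (FreeAlgebra.ι k i * FreeAlgebra.ι k j)
        (q • (FreeAlgebra.ι k j * FreeAlgebra.ι k i))

/-- The homogeneous quantum complete intersection `A = k⟨x_1,…,x_c⟩/(x_i^a, x_ix_j - q x_jx_i)`. -/
abbrev QCI (k : Type) [Field k] (c a : ℕ) (q : k) : Type := RingQuot (QCIRel k c a q)

/-- The image of the generator `x_i` in `A`. -/
noncomputable def Xgen (k : Type) [Field k] (c a : ℕ) (q : k) (i : Fin c) : QCI k c a q :=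
  RingQuot.mkAlgHom k (QCIRel k c a q) (FreeAlgebra.ι k i)

/-- The element `u_λ = λ_1 x_1 + ⋯ + λ_c x_c` of `A`. -/
noncomputable def uElt (k : Type) [Field k] (c a : ℕ) (q : k) (lam : Fin c → k) :
    QCI k c a q :=
  ∑ i, lam i • Xgen k c a q i

/-- The rank variety of an `A`-module `M`: the set of `λ ∈ k^c` which are zero or such
that `M`, regarded as a `k[u_λ]`-module by restriction of scalars along the inclusion
`k[u_λ] ⊆ A`, is not free. -/
def rankVariety (k : Type) [Field k] (c a : ℕ) (q : k)
    (M : Type) [AddCommGroup M] [Module (QCI k c a q) M] : Set (Fin c → k) :=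
  {lam | lam = 0 ∨ (lam ≠ 0 ∧
    ¬ @Module.Free (Algebra.adjoin k {uElt k c a q lam}) M _ _
      (Module.compHom M (Algebra.adjoin k {uElt k c a q lam}).val.toRingHom))}

/-- Gaussian binomial coefficients, defined by the `q`-Pascal recursion. -/
def gaussBinom {k : Type*} [CommRing k] (q : k) : ℕ → ℕ → k
  | _, 0 => 1
  | 0, _ + 1 => 0
  | n + 1, m + 1 => gaussBinom q n m + q ^ (m + 1) * gaussBinom q n (m + 1)

section
variable {k : Type*} [CommRing k] (q : k)

@[simp] lemma gaussBinom_zero_right (n : ℕ) : gaussBinom q n 0 = 1 := by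
  cases n <;> simp [gaussBinom]

@[simp] lemma gaussBinom_zero_succ (m : ℕ) : gaussBinom q 0 (m + 1) = 0 := by
  simp [gaussBinom]

lemma gaussBinom_succ_succ (n m : ℕ) :
    gaussBinom q (n + 1) (m + 1) =
      gaussBinom q n m + q ^ (m + 1) * gaussBinom q n (m + 1) := by
  simp [gaussBinom]

lemma gaussBinom_eq_zero_of_lt {n m : ℕ} (h : n < m) : gaussBinom q n m = 0 := by
  induction n generalizing m with
  | zero => obtain ⟨m, rfl⟩ := Nat.exists_eq_succ_of_ne_zero h.ne'; simp
  | succ n ih =>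
    obtain ⟨m, rfl⟩ := Nat.exists_eq_succ_of_ne_zero (Nat.ne_zero_of_lt h)
    rw [Nat.succ_eq_add_one, gaussBinom_succ_succ, ih (by omega), ih (by omega)]
    simp

lemma gaussBinom_self (n : ℕ) : gaussBinom q n n = 1 := by
  induction n with
  | zero => simp
  | succ n ih => simp [gaussBinom_succ_succ, ih, gaussBinom_eq_zero_of_lt q (Nat.lt_succ_self n)]

lemma gaussBinom_succ_right (n m : ℕ) :
    q ^ m * (1 - q ^ (m + 1)) * gaussBinom q n (m + 1) = (q ^ m - q ^ n) * gaussBinom q n m := by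
  induction n generalizing m with
  | zero => cases m <;> simp
  | succ n ih =>
    cases m with
    | zero =>
      have h := ih 0
      simp only [gaussBinom_succ_succ, gaussBinom_zero_right] at h ⊢
      linear_combination q * h
    | succ m =>
      have h := ih m
      have h' := ih (m + 1)
      simp only [gaussBinom_succ_succ] at h h' ⊢
      linear_combination q ^ (m + 2) * h' + q * h

lemma gaussBinom_eq_zero_of_isPrimitiveRoot [IsDomain k] {b : ℕ} (hq : IsPrimitiveRoot q b)
    {m : ℕ} (hm : m ≠ 0) (hmb : m < b) : gaussBinom q b m = 0 := by
  have hq0 : q ≠ 0 := hq.ne_zero (by omega)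
  induction m with
  | zero => exact absurd rfl hm
  | succ m ih =>
    have h := gaussBinom_succ_right q b m
    have h1 : (q ^ m - q ^ b) * gaussBinom q b m = 0 := by
      rcases Nat.eq_zero_or_pos m with rfl | h0
      · simp [hq.pow_eq_one]
      · rw [ih h0.ne' (by omega), mul_zero]
    rw [h1] at h
    have h2 : 1 - q ^ (m + 1) ≠ 0 :=
      sub_ne_zero.2 (hq.pow_ne_one_of_pos_of_lt (by omega) hmb).symm
    simpa [hq0, h2] using h

end

section
variable {k R : Type*} [Field k] [Ring R] [Algebra k R] {q : k} {x y : R}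

lemma mul_pow_of_mul_eq_smul (h : x * y = q • (y * x)) (m : ℕ) :
    x * y ^ m = q ^ m • (y ^ m * x) := by
  induction m with
  | zero => simp
  | succ m ih =>
    rw [pow_succ, ← mul_assoc, ih, smul_mul_assoc, mul_assoc, h, mul_smul_comm, smul_smul,
      ← pow_succ, mul_assoc]

lemma pow_mul_of_mul_eq_smul (h : x * y = q • (y * x)) (m : ℕ) :
    x ^ m * y = q ^ m • (y * x ^ m) := by
  induction m with
  | zero => simp
  | succ m ih =>
    rw [pow_succ', mul_assoc, ih, mul_smul_comm, ← mul_assoc, h, smul_mul_assoc, smul_smul,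
      ← pow_succ, mul_assoc]

lemma add_pow_of_mul_eq_smul (h : x * y = q • (y * x)) (n : ℕ) :
    (x + y) ^ n = ∑ ij ∈ Finset.HasAntidiagonal.antidiagonal n, gaussBinom q n ij.1 • (y ^ ij.1 * x ^ ij.2) := by
  induction n with
  | zero => simp
  | succ n ih =>
    have hx : ∀ ij : ℕ × ℕ, x * (y ^ ij.1 * x ^ ij.2) = q ^ ij.1 • (y ^ ij.1 * x ^ (ij.2 + 1)) := by
      intro ij
      rw [← mul_assoc, mul_pow_of_mul_eq_smul h, smul_mul_assoc, mul_assoc, ← pow_succ']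
    rw [pow_succ', ih, add_mul, Finset.mul_sum, Finset.mul_sum]
    simp_rw [mul_smul_comm, hx, ← mul_assoc, ← pow_succ']
    have h1 : ∑ ij ∈ Finset.HasAntidiagonal.antidiagonal (n + 1), (q ^ ij.1 * gaussBinom q n ij.1) •
        (y ^ ij.1 * x ^ ij.2) = ∑ ij ∈ Finset.HasAntidiagonal.antidiagonal n,
          gaussBinom q n ij.1 • q ^ ij.1 • (y ^ ij.1 * x ^ (ij.2 + 1)) := by
      rw [Finset.Nat.sum_antidiagonal_succ', gaussBinom_eq_zero_of_lt q (Nat.lt_succ_self n)]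
      simp [smul_smul, mul_comm]
    rw [← h1, Finset.Nat.sum_antidiagonal_succ, Finset.Nat.sum_antidiagonal_succ]
    simp only [gaussBinom_succ_succ, gaussBinom_zero_right, add_smul, Finset.sum_add_distrib]
    simp [add_comm, add_left_comm]

lemma add_pow_of_isPrimitiveRoot {b : ℕ} (hb : b ≠ 0) (hq : IsPrimitiveRoot q b)
    (h : x * y = q • (y * x)) : (x + y) ^ b = x ^ b + y ^ b := by
  rw [add_pow_of_mul_eq_smul h]
  obtain ⟨b, rfl⟩ := Nat.exists_eq_succ_of_ne_zero hb
  rw [Nat.succ_eq_add_one, Finset.Nat.sum_antidiagonal_succ]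
  cases b with
  | zero => simp [gaussBinom_self]
  | succ b =>
    rw [Finset.Nat.sum_antidiagonal_succ', Finset.sum_eq_zero]
    · simp [gaussBinom_self]
    · intro ij hij
      rw [Finset.HasAntidiagonal.mem_antidiagonal] at hij
      rw [gaussBinom_eq_zero_of_isPrimitiveRoot q hq (by omega) (by omega), zero_smul]

lemma add_pow_of_mul_eq_smul_of_isPrimitiveRoot {a b : ℕ} (ha : a ≠ 0)
    (hb : b = if ringChar k = 0 then a else a / Nat.gcd a (ringChar k))
    (hq : IsPrimitiveRoot q b) (h : x * y = q • (y * x)) : (x + y) ^ a = x ^ a + y ^ a := by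
  by_cases hab : b = a
  · exact add_pow_of_isPrimitiveRoot ha (hab ▸ hq) h
  have hp0 : ringChar k ≠ 0 := fun h0 ↦ hab (by rw [hb, if_pos h0])
  rw [if_neg hp0] at hb
  have hp : (ringChar k).Prime := (CharP.char_is_prime_or_zero k _).resolve_right hp0
  have hdvd : ringChar k ∣ a := by
    by_contra hd
    rw [Nat.Coprime.gcd_eq_one ((hp.coprime_iff_not_dvd.2 hd).symm), Nat.div_one] at hb
    exact hab hb
  rw [Nat.gcd_eq_right hdvd] at hb
  have hab' : a = b * ringChar k := by rw [hb, Nat.div_mul_cancel hdvd]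
  have hb0 : b ≠ 0 := by rintro rfl; simp at hab'; exact ha hab'
  nontriviality R
  have : Fact (ringChar k).Prime := ⟨hp⟩
  have : CharP R (ringChar k) := charP_of_injective_algebraMap (algebraMap k R).injective _
  have hc : Commute (x ^ b) (y ^ b) := by
    have := pow_mul_of_mul_eq_smul h b
    rw [hq.pow_eq_one, one_smul] at this
    exact Commute.pow_right this b
  rw [hab', pow_mul, add_pow_of_isPrimitiveRoot hb0 hq h, add_pow_char_of_commute _ hc,
    pow_mul, pow_mul]

lemma sum_pow_of_mul_eq_smul {ι : Type*} [LinearOrder ι] {a b : ℕ} (ha : a ≠ 0)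
    (hb : b = if ringChar k = 0 then a else a / Nat.gcd a (ringChar k))
    (hq : IsPrimitiveRoot q b) (z : ι → R) (hz : ∀ i j, i < j → z i * z j = q • (z j * z i))
    (s : Finset ι) : (∑ i ∈ s, z i) ^ a = ∑ i ∈ s, z i ^ a := by
  induction s using Finset.induction_on_min with
  | empty => simp [ha]
  | insert i s hi ih =>
    have his : i ∉ s := fun h ↦ lt_irrefl _ (hi i h)
    rw [Finset.sum_insert his, Finset.sum_insert his,
      add_pow_of_mul_eq_smul_of_isPrimitiveRoot ha hb hq, ih]
    rw [Finset.mul_sum, Finset.sum_mul, Finset.smul_sum]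
    exact Finset.sum_congr rfl fun j hj ↦ hz i j (hi j hj)

end

section
variable {k V : Type*} [Field k] [AddCommGroup V] [Module k V]

lemma LinearMap.exists_generalized_inverse {W : Type*} [AddCommGroup W] [Module k W]
    (f : V →ₗ[k] W) : ∃ s : W →ₗ[k] V, ∀ v, f (s (f v)) = f v := by
  obtain ⟨h, hh⟩ := f.rangeRestrict.exists_rightInverse_of_surjective f.range_rangeRestrict
  obtain ⟨s, hs⟩ := h.exists_extend
  refine ⟨s, fun v ↦ ?_⟩
  have h1 : s (f v) = h (f.rangeRestrict v) := LinearMap.congr_fun hs (f.rangeRestrict v)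
  rw [h1]
  exact congrArg Subtype.val (LinearMap.congr_fun hh (f.rangeRestrict v))

lemma ker_le_range_iff_exists_det_ne_zero [FiniteDimensional k V] {f g : Module.End k V}
    (hfg : f * g = 0) :
    f.ker ≤ g.range ↔ ∃ s t : Module.End k V, (s * f + g * t).det ≠ 0 := by
  constructor
  · intro h
    obtain ⟨s, hs⟩ := f.exists_generalized_inverse
    obtain ⟨t, ht⟩ := g.exists_generalized_inverse
    refine ⟨s, t * (1 - s * f), ?_⟩
    have : s * f + g * (t * (1 - s * f)) = 1 := by
      ext v
      obtain ⟨w, hw⟩ : v - s (f v) ∈ g.range := h (by simp [hs])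
      simp [← hw, ht]
      simp [hw]
    simp [this]
  · rintro ⟨s, t, hdet⟩
    have hle : g.range ≤ f.ker := by
      rintro _ ⟨v, rfl⟩
      exact LinearMap.congr_fun hfg v
    have hsurj : (s * f + g * t).range = ⊤ := by
      have := (LinearMap.isUnit_iff_isUnit_det _).2 (isUnit_iff_ne_zero.2 hdet)
      exact (LinearMap.isUnit_iff_range_eq_top _).1 this
    have htop : (⊤ : Submodule k V) ≤ f.range.map s ⊔ g.range := by
      rw [← hsurj]
      rintro _ ⟨v, rfl⟩
      exact Submodule.add_mem_sup ⟨f v, ⟨v, rfl⟩, rfl⟩ ⟨t v, rfl⟩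
    have h1 := Submodule.finrank_mono htop
    have h2 := Submodule.finrank_add_le_finrank_add_finrank (f.range.map s) g.range
    have h3 := Submodule.finrank_map_le s f.range
    have h4 := f.finrank_range_add_finrank_ker
    rw [finrank_top] at h1
    exact (Submodule.eq_of_le_of_finrank_le hle (by omega)).ge

end

section
variable {k R M : Type*} [Field k] [CommRing R] [Algebra k R] [AddCommGroup M] [Module R M]
  [Module k M] [IsScalarTower k R M] {u : R} {a : ℕ}

/-- For an algebra `R = k[u]` with `u ^ a = 0`, a module is free as soon as multiplication by `u`
is exact against multiplication by `u ^ (a - 1)`. -/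
lemma free_of_forall_smul_eq_zero (hR : ∀ r : R, ∃ (c : k) (s : R), r = algebraMap k R c + u * s)
    (hu : u ^ (a + 1) = 0) (hM : ∀ m : M, u • m = 0 → ∃ n : M, u ^ a • n = m) :
    Module.Free R M := by
  let K : Submodule k M :=
    { carrier := {m | u • m = 0}
      add_mem' := fun {x y} hx hy ↦ by
        simp only [Set.mem_ofPred_eq] at hx hy ⊢
        rw [smul_add, hx, hy, add_zero]
      zero_mem' := smul_zero u
      smul_mem' := fun c x hx ↦ by
        simp only [Set.mem_ofPred_eq] at hx ⊢
        rw [← algebraMap_smul R c x, smul_comm, hx, smul_zero] }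
  let e := Module.Basis.ofVectorSpace k K
  choose w hw using fun i ↦ hM (e i : M) (e i).2
  have hsmul : ∀ (c : k) (m : M), algebraMap k R c • m = c • m := algebraMap_smul R
  have hli : LinearIndependent R w := by
    rw [linearIndependent_iff']
    intro S r hr
    have key : ∀ j ≤ a + 1, ∀ i ∈ S, ∃ s, r i = u ^ j * s := by
      intro j
      induction j with
      | zero => exact fun _ i _ ↦ ⟨r i, by simp⟩
      | succ j ih =>
        intro hj
        choose! s hs using ih (by omega)
        choose c s' hs' using fun i ↦ hR (s i)
        have h0 : ∑ i ∈ S, c i • e i = 0 := by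
          apply Subtype.ext
          have h1 : u ^ (a - j) • ∑ i ∈ S, r i • w i = 0 := by rw [hr, smul_zero]
          rw [Finset.smul_sum] at h1
          rw [Submodule.coe_sum, Submodule.coe_zero, ← h1]
          refine Finset.sum_congr rfl fun i hi ↦ ?_
          have h2 : u ^ (a - j) * r i = u ^ a * s i := by
            rw [hs i hi, ← mul_assoc, ← pow_add, Nat.sub_add_cancel (by omega)]
          have h3 : u ^ a * s i = algebraMap k R (c i) * u ^ a := by
            rw [hs' i, mul_add, ← mul_assoc, ← pow_succ, hu, zero_mul, add_zero, mul_comm]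
          rw [smul_smul, h2, h3, mul_smul, hw, hsmul, Submodule.coe_smul]
        have hc := linearIndependent_iff'.1 e.linearIndependent S c h0
        intro i hi
        refine ⟨s' i, ?_⟩
        rw [hs i hi, hs' i, hc i hi, map_zero, zero_add, ← mul_assoc, pow_succ]
    intro i hi
    obtain ⟨s, hs⟩ := key (a + 1) le_rfl i hi
    rw [hs, hu, zero_mul]
  have hspan : ∀ j ≤ a + 1, ∀ m : M, u ^ j • m = 0 → m ∈ Submodule.span R (Set.range w) := by
    intro j
    induction j with
    | zero =>
      intro _ m hm
      rw [pow_zero, one_smul] at hm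
      exact hm ▸ zero_mem _
    | succ j ih =>
      intro hj m hm
      have hK : u ^ j • m ∈ K := by
        change u • u ^ j • m = 0
        rw [smul_smul, ← pow_succ', hm]
      obtain ⟨n, hn, hnm⟩ : ∃ n ∈ Submodule.span R (Set.range w), u ^ a • n = u ^ j • m := by
        have h1 := congrArg Subtype.val (e.linearCombination_repr ⟨_, hK⟩)
        rw [Finsupp.linearCombination_apply, Finsupp.sum, Submodule.coe_sum] at h1
        change _ = u ^ j • m at h1
        refine ⟨∑ i ∈ (e.repr ⟨_, hK⟩).support, algebraMap k R (e.repr ⟨_, hK⟩ i) • w i,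
          Submodule.sum_mem _ fun i _ ↦ Submodule.smul_mem _ _ (Submodule.subset_span ⟨i, rfl⟩), ?_⟩
        rw [Finset.smul_sum]
        refine Eq.trans ?_ h1
        refine Finset.sum_congr rfl fun i _ ↦ ?_
        rw [smul_comm, hw, hsmul, Submodule.coe_smul]
      have h2 : m - u ^ (a - j) • n ∈ Submodule.span R (Set.range w) := by
        apply ih (by omega)
        rw [smul_sub, smul_smul, ← pow_add, Nat.add_sub_cancel' (by omega), hnm, sub_self]
      simpa using add_mem h2 (Submodule.smul_mem _ (u ^ (a - j)) hn)
  exact Module.Free.of_basis (Module.Basis.mk hli fun m _ ↦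
    hspan (a + 1) le_rfl m (by rw [hu, zero_smul]))

lemma exists_smul_eq_of_free [Module.Free R M]
    (hR : ∀ r : R, u * r = 0 → ∃ s, r = u ^ a * s) {m : M} (hm : u • m = 0) :
    ∃ n : M, u ^ a • n = m := by
  let e := Module.Free.chooseBasis R M
  have h : ∀ i, ∃ s, e.repr m i = u ^ a * s := fun i ↦ hR _ (by
    have := congrArg (fun x ↦ e.repr x i) hm
    simpa using this)
  choose s hs using h
  refine ⟨∑ i ∈ (e.repr m).support, s i • e i, ?_⟩
  conv_rhs => rw [← e.linearCombination_repr m, Finsupp.linearCombination_apply, Finsupp.sum]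
  rw [Finset.smul_sum]
  exact Finset.sum_congr rfl fun i _ ↦ by rw [hs, mul_smul]

end

section
variable {k B : Type*} [Field k] [Ring B] [Algebra k B] {u : B} {a : ℕ}

lemma exists_eq_aeval_of_mem_adjoin_singleton (r : Algebra.adjoin k {u}) :
    ∃ p : Polynomial k, r = Polynomial.aeval
      (⟨u, Algebra.self_mem_adjoin_singleton k u⟩ : Algebra.adjoin k {u}) p := by
  obtain ⟨p, hp⟩ := (Algebra.adjoin_singleton_eq_range_aeval k u).le r.2
  refine ⟨p, Subtype.ext ?_⟩
  rw [Polynomial.aeval_subalgebra_coe]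
  exact hp.symm

lemma X_pow_dvd_of_aeval_eq_zero (hu : u ^ (a + 1) = 0) (hu' : u ^ a ≠ 0)
    {p : Polynomial k} (hp : Polynomial.aeval u p = 0) : Polynomial.X ^ (a + 1) ∣ p := by
  have hdvd : minpoly k u ∣ Polynomial.X ^ (a + 1) := minpoly.dvd k u (by simp [hu])
  obtain ⟨j, hj, hass⟩ := (dvd_prime_pow Polynomial.prime_X _).1 hdvd
  have hja : j = a + 1 := by
    by_contra hne
    obtain ⟨d, hd⟩ := Nat.exists_eq_add_of_le (show j ≤ a by omega)
    have h0 : Polynomial.aeval u (Polynomial.X ^ j : Polynomial k) = 0 := by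
      obtain ⟨d, hd⟩ := hass.dvd
      rw [hd, map_mul, minpoly.aeval, zero_mul]
    apply hu'
    rw [hd, pow_add]
    simp only [map_pow, Polynomial.aeval_X] at h0
    rw [h0, zero_mul]
  rw [← hja]
  exact hass.symm.dvd.trans (minpoly.dvd k u hp)

open Algebra in
lemma free_adjoin_iff {M : Type*} [AddCommGroup M]
    [Module (adjoin k {u}) M] [Module k M] [IsScalarTower k (adjoin k {u}) M]
    (hu : u ^ (a + 1) = 0) (hu' : u ^ a ≠ 0) :
    Module.Free (adjoin k {u}) M ↔
      ∀ m : M, (⟨u, self_mem_adjoin_singleton k u⟩ : adjoin k {u}) • m = 0 →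
        ∃ n : M, (⟨u, self_mem_adjoin_singleton k u⟩ : adjoin k {u}) ^ a • n = m := by
  have _ : IsMulCommutative (adjoin k {u}) := isMulCommutative_adjoin k (by simp)
  set v : adjoin k {u} := ⟨u, self_mem_adjoin_singleton k u⟩ with hv
  have hva : v ^ (a + 1) = 0 := Subtype.ext hu
  have hva' : v ^ a ≠ 0 := fun h ↦ hu' (congrArg Subtype.val h)
  constructor
  · intro hfree m hm
    refine exists_smul_eq_of_free (fun r hr ↦ ?_) hm
    obtain ⟨p, rfl⟩ := exists_eq_aeval_of_mem_adjoin_singleton r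
    have h0 : Polynomial.aeval v (Polynomial.X * p) = 0 := by
      rw [map_mul, Polynomial.aeval_X]
      exact hr
    have h1 := X_pow_dvd_of_aeval_eq_zero hva hva' h0
    rw [pow_succ', mul_dvd_mul_iff_left Polynomial.X_ne_zero] at h1
    obtain ⟨s, rfl⟩ := h1
    exact ⟨Polynomial.aeval v s, by simp [hv]⟩
  · intro h
    refine free_of_forall_smul_eq_zero (k := k) (fun r ↦ ?_) hva h
    obtain ⟨p, rfl⟩ := exists_eq_aeval_of_mem_adjoin_singleton r
    refine ⟨p.coeff 0, Polynomial.aeval v p.divX, ?_⟩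
    conv_lhs => rw [← Polynomial.divX_mul_X_add p]
    rw [map_add, map_mul, Polynomial.aeval_X, Polynomial.aeval_C, add_comm, mul_comm]
end

section
variable {k : Type} [Field k] {c a b : ℕ} {q : k}

lemma Xgen_pow (i : Fin c) : Xgen k c a q i ^ a = 0 := by
  have := RingQuot.mkAlgHom_rel k (QCIRel.pow (a := a) (q := q) i)
  simpa [Xgen] using this

lemma Xgen_mul (i j : Fin c) (hij : i < j) :
    Xgen k c a q i * Xgen k c a q j = q • (Xgen k c a q j * Xgen k c a q i) := by
  have := RingQuot.mkAlgHom_rel k (QCIRel.comm (a := a) (q := q) i j hij)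
  simpa [Xgen] using this

lemma uElt_pow (ha : a ≠ 0) (hb : b = if ringChar k = 0 then a else a / Nat.gcd a (ringChar k))
    (hq : IsPrimitiveRoot q b) (lam : Fin c → k) : uElt k c a q lam ^ a = 0 := by
  rw [uElt, sum_pow_of_mul_eq_smul ha hb hq]
  · exact Finset.sum_eq_zero fun i _ ↦ by rw [smul_pow, Xgen_pow, smul_zero]
  · intro i j hij
    rw [smul_mul_smul_comm, smul_mul_smul_comm, Xgen_mul i j hij, smul_comm, mul_comm]

/-- The algebra map `A → k[x]/(x ^ a)` sending `x_i` to `x` and the other generators to zero. -/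
noncomputable def toTruncated (ha : a ≠ 0) (i : Fin c) :
    QCI k c a q →ₐ[k] AdjoinRoot (Polynomial.X ^ a : Polynomial k) :=
  RingQuot.liftAlgHom k ⟨FreeAlgebra.lift k (Pi.single i (AdjoinRoot.root _)), fun x y h ↦ by
    induction h with
    | pow j =>
      rcases eq_or_ne j i with rfl | hj
      · have := AdjoinRoot.eval₂_root (Polynomial.X ^ a : Polynomial k)
        simpa using this
      · simp [hj, ha]
    | comm j l hjl =>
      rcases eq_or_ne j i with rfl | hj
      · simp [hjl.ne']
      · simp [hj]⟩

lemma toTruncated_uElt (ha : a ≠ 0) (i : Fin c) (lam : Fin c → k) :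
    toTruncated ha i (uElt k c a q lam) = lam i • AdjoinRoot.root _ := by
  simp only [uElt, map_sum, map_smul, Xgen, toTruncated, RingQuot.liftAlgHom_mkAlgHom_apply,
    FreeAlgebra.lift_ι_apply]
  rw [Finset.sum_eq_single i]
  · simp
  · intro j _ hj
    simp [hj]
  · simp

lemma uElt_pow_ne_zero {lam : Fin c → k} (hlam : lam ≠ 0) :
    uElt k c (a + 1) q lam ^ a ≠ 0 := by
  obtain ⟨i, hi⟩ := Function.ne_iff.1 hlam
  intro h
  have h1 := congrArg (toTruncated a.succ_ne_zero i) h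
  rw [map_pow, toTruncated_uElt, map_zero, smul_pow, smul_eq_zero] at h1
  have h2 := h1.resolve_left (pow_ne_zero _ hi)
  rw [AdjoinRoot.root, ← map_pow, AdjoinRoot.mk_eq_zero,
    pow_dvd_pow_iff Polynomial.X_ne_zero Polynomial.not_isUnit_X] at h2
  omega

variable {M : Type} [AddCommGroup M] [Module (QCI k c a q) M]
  [Module k M] [IsScalarTower k (QCI k c a q) M]

variable (k c a q M) in
/-- The action of `u_λ` on a module. -/
noncomputable def uAction (lam : Fin c → k) : Module.End k M :=
  Algebra.lsmul k k M (uElt k c a q lam)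

lemma uAction_eq_sum (lam : Fin c → k) :
    uAction k c a q M lam = ∑ i, lam i • Algebra.lsmul k k M (Xgen k c a q i) := by
  simp [uAction, uElt]

lemma mem_rankVariety_iff [FiniteDimensional k M] [Nontrivial M] (ha : 2 ≤ a)
    (hb : b = if ringChar k = 0 then a else a / Nat.gcd a (ringChar k))
    (hq : IsPrimitiveRoot q b) (lam : Fin c → k) :
    lam ∈ rankVariety k c a q M ↔ ∀ s t : Module.End k M,
      (s * uAction k c a q M lam + uAction k c a q M lam ^ (a - 1) * t).det = 0 := by
  obtain ⟨a, rfl⟩ := Nat.exists_eq_add_of_le' (show 1 ≤ a by omega)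
  rcases eq_or_ne lam 0 with rfl | hlam
  · have h0 : uAction k c (a + 1) q M 0 = 0 := by simp [uAction_eq_sum]
    have ha0 : a ≠ 0 := by omega
    simp [rankVariety, h0, ha0]
  have hu : uElt k c (a + 1) q lam ^ (a + 1) = 0 := uElt_pow a.succ_ne_zero hb hq lam
  have hu' := uElt_pow_ne_zero (q := q) (a := a) hlam
  have hU : uAction k c (a + 1) q M lam * uAction k c (a + 1) q M lam ^ a = 0 := by
    rw [← pow_succ', uAction, ← map_pow, hu, map_zero]
  let _ : Module (Algebra.adjoin k {uElt k c (a + 1) q lam}) M :=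
    Module.compHom M (Algebra.adjoin k {uElt k c (a + 1) q lam}).val.toRingHom
  have hfree := @free_adjoin_iff k _ _ _ _ _ a M _
    (Module.compHom M (Algebra.adjoin k {uElt k c (a + 1) q lam}).val.toRingHom) _
    ⟨fun x y z ↦ smul_assoc x (y : QCI k c (a + 1) q) z⟩ hu hu'
  have hker := ker_le_range_iff_exists_det_ne_zero hU
  have hiff : Module.Free (Algebra.adjoin k {uElt k c (a + 1) q lam}) M ↔
      (uAction k c (a + 1) q M lam).ker ≤ (uAction k c (a + 1) q M lam ^ a).range := by
    rw [hfree, uAction, ← map_pow]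
    exact Iff.rfl
  simp only [rankVariety, Set.mem_ofPred_eq, hlam, false_or, ne_eq, not_false_eq_true, true_and]
  rw [hiff, hker]
  push Not
  rfl

/-- The determinant condition cutting out the rank variety, as a polynomial in `λ`. -/
lemma exists_eval_eq_det [FiniteDimensional k M] (n : ℕ) (s t : Module.End k M) :
    ∃ p : MvPolynomial (Fin c) k, ∀ lam, MvPolynomial.eval lam p =
      (s * uAction k c a q M lam + uAction k c a q M lam ^ n * t).det := by
  let e := Module.finBasis k M
  let m : Module.End k M → Matrix _ _ (MvPolynomial (Fin c) k) := fun f ↦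
    (LinearMap.toMatrixAlgEquiv e f).map MvPolynomial.C
  let U := ∑ i, (MvPolynomial.X i : MvPolynomial (Fin c) k) •
    m (Algebra.lsmul k k M (Xgen k c a q i))
  refine ⟨(m s * U + U ^ n * m t).det, fun lam ↦ ?_⟩
  have hm : ∀ f, (MvPolynomial.eval lam).mapMatrix (m f) = LinearMap.toMatrixAlgEquiv e f := by
    intro f
    ext i j
    simp [m]
  have hU : (MvPolynomial.eval lam).mapMatrix U =
      LinearMap.toMatrixAlgEquiv e (uAction k c a q M lam) := by
    rw [uAction_eq_sum, map_sum, map_sum]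
    refine Finset.sum_congr rfl fun l _ ↦ ?_
    rw [map_smul (LinearMap.toMatrixAlgEquiv e), ← hm]
    ext i j
    simp
  rw [RingHom.map_det, map_add, map_mul, map_mul, map_pow, hm, hm, hU, ← map_pow, ← map_mul,
    ← map_mul, ← map_add]
  exact LinearMap.det_toMatrix e _

end

/-- for every finite-dimensional left `A`-module `M`, the rank variety
`V^r_A(M)` is a homogeneous affine subset of `k^c`: it is closed under multiplication by
scalars from `k`, and it is Zariski closed, i.e. it is the common zero set of a family of
polynomials in `k[t_1, …, t_c]`. -/
theorem statement17 (k : Type) [Field k] [IsAlgClosed k] (c a : ℕ) (hc : 2 ≤ c) (ha : 2 ≤ a)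
    (b : ℕ) (hb : b = if ringChar k = 0 then a else a / Nat.gcd a (ringChar k))
    (q : k) (hq : IsPrimitiveRoot q b)
    (M : Type) [AddCommGroup M] [Module (QCI k c a q) M]
    [Module k M] [IsScalarTower k (QCI k c a q) M] [FiniteDimensional k M] :
    (∀ (t : k) (lam : Fin c → k),
      lam ∈ rankVariety k c a q M → t • lam ∈ rankVariety k c a q M) ∧
    (∃ P : Set (MvPolynomial (Fin c) k),
      rankVariety k c a q M = {lam | ∀ p ∈ P, MvPolynomial.eval lam p = 0}) := by
  rcases subsingleton_or_nontrivial M with _ | _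
  · have hV : rankVariety k c a q M = {0} := by
      ext lam
      simp only [rankVariety, Set.mem_ofPred_eq, Set.mem_singleton_iff, or_iff_left_iff_imp]
      exact fun h ↦ absurd (@Module.Free.of_subsingleton _ _ _ _ _ _) h.2
    rw [hV]
    refine ⟨fun t lam h ↦ ?_, Set.range MvPolynomial.X, ?_⟩
    · rw [Set.mem_singleton_iff] at h ⊢
      rw [h, smul_zero]
    · ext lam
      simp [funext_iff]
  have hV := mem_rankVariety_iff (M := M) (c := c) ha hb hq
  constructor
  · intro t lam h
    rw [hV] at h ⊢
    intro f g
    have hu : uAction k c a q M (t • lam) = t • uAction k c a q M lam := by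
      simp [uAction_eq_sum, Finset.smul_sum, mul_smul]
    have := h (t • f) (t ^ (a - 1) • g)
    rwa [smul_mul_assoc, ← mul_smul_comm, mul_smul_comm (t ^ (a - 1)), ← smul_mul_assoc,
      ← smul_pow, ← hu] at this
  · choose p hp using exists_eval_eq_det (k := k) (c := c) (a := a) (q := q) (M := M) (a - 1)
    refine ⟨Set.range (Function.uncurry p), ?_⟩
    ext lam
    rw [hV, Set.mem_ofPred_eq, Set.forall_mem_range, Prod.forall]
    simp only [Function.uncurry_apply_pair, hp]
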